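/- Let λ, λ' ∈ 𝔫* with λ' ∈ λ·S̄_λ, and let μ' be the restriction of λ' to 𝔰̄_λ. Then the Kirillov function ψ_{λ'} is an irreducible character of G if and only if the Kirillov function ψ_{μ'} of the algebra group S̄_λ is an irreducible character of S̄_λ. -/

import Mathlib

open scoped Classical BigOperators ComplexOrder

set_option linter.unusedSectionVars false
set_option linter.unusedVariables false

noncomputable section

namespace IterChar

/-! ### Generic notions for finite groups: inner product, induction, characters -/

/-- The standard inner product `⟨f,h⟩_G = |G|⁻¹ ∑_{x ∈ G} f x * conj (h x)`. -/
def innerG (G : Type) [Group G] (f h : G → ℂ) : ℂ :=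
  (Nat.card G : ℂ)⁻¹ * ∑ᶠ x : G, f x * (starRingEnd ℂ) (h x)

/-- Induction of a function from a subgroup, via the Frobenius formula. -/
def indFun {G : Type} [Group G] (H : Subgroup G) (ψ : ↥H → ℂ) : G → ℂ :=
  fun g => (Nat.card ↥H : ℂ)⁻¹ *
    ∑ᶠ x : G, if h : x * g * x⁻¹ ∈ H then ψ ⟨x * g * x⁻¹, h⟩ else 0

/-- A function `G → ℂ` is a character if it is the trace character of some
finite-dimensional complex representation. -/
def IsCharacter (G : Type) [Group G] (f : G → ℂ) : Prop :=
  ∃ V : FDRep ℂ G, f = FDRep.character V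

/-- The set of irreducible characters of `G`: characters of norm one. -/
def Irr (G : Type) [Group G] : Set (G → ℂ) :=
  {f | IsCharacter G f ∧ innerG G f f = 1}

/-- The set of irreducible constituents of `χ`: irreducible characters with
`⟨χ, ψ⟩_G > 0` (using the complex partial order). -/
def IrrConstituents (G : Type) [Group G] (χ : G → ℂ) : Set (G → ℂ) :=
  {f | f ∈ Irr G ∧ 0 < innerG G χ f}

/-! ### Algebra groups -/

variable {F : Type} [Field F] [Fintype F] {R : Type} [Ring R] [Algebra F R] [Fintype R]

/-- `J` is a nilpotent (non-unital) subalgebra: all products of some fixed length vanish. -/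
def IsNil (J : NonUnitalSubalgebra F R) : Prop :=
  ∃ N : ℕ, ∀ l : List R, (∀ x ∈ l, x ∈ J) → l.length = N → l.prod = 0

/-- The algebra group `G = 1 + J` of a (nilpotent) subalgebra `J ⊆ R`, realized as the
subgroup of units `u` of `R` with `u - 1 ∈ J` (and `u⁻¹ - 1 ∈ J`, which is automatic
when `J` is nilpotent). -/
def algGroup (F : Type) [Field F] [Fintype F] (R : Type) [Ring R] [Algebra F R] [Fintype R]
    (J : NonUnitalSubalgebra F R) : Subgroup Rˣ where
  carrier := {u : Rˣ | ((u : R) - 1 ∈ J) ∧ (((u⁻¹ : Rˣ) : R) - 1 ∈ J)}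
  one_mem' := by
    constructor <;> · simp only [Units.val_one, inv_one, sub_self]; exact J.zero_mem
  mul_mem' := by
    rintro u v ⟨hu1, hu2⟩ ⟨hv1, hv2⟩
    constructor
    · have h : ((u * v : Rˣ) : R) - 1 =
          ((u : R) - 1) * ((v : R) - 1) + ((u : R) - 1) + ((v : R) - 1) := by
        push_cast; noncomm_ring
      rw [h]
      exact add_mem (add_mem (mul_mem hu1 hv1) hu1) hv1
    · have h : (((u * v)⁻¹ : Rˣ) : R) - 1 =
          (((v⁻¹ : Rˣ) : R) - 1) * (((u⁻¹ : Rˣ) : R) - 1) +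
            (((v⁻¹ : Rˣ) : R) - 1) + (((u⁻¹ : Rˣ) : R) - 1) := by
        rw [mul_inv_rev]; push_cast; noncomm_ring
      rw [h]
      exact add_mem (add_mem (mul_mem hv2 hu2) hv2) hu2
  inv_mem' := by
    rintro u ⟨h1, h2⟩
    exact ⟨h2, by simpa using h1⟩

theorem mem_algGroup {J : NonUnitalSubalgebra F R} {u : Rˣ} :
    u ∈ algGroup F R J ↔ ((u : R) - 1 ∈ J) ∧ (((u⁻¹ : Rˣ) : R) - 1 ∈ J) :=
  Iff.rfl

/-- The element `X ∈ J` such that `g = 1 + X`. -/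
def gElt {J : NonUnitalSubalgebra F R} (g : ↥(algGroup F R J)) : ↥J :=
  ⟨((g : Rˣ) : R) - 1, g.2.1⟩

/-- The function `θ_λ(1+X) = θ(λ(X))` on the algebra group `1 + J`. -/
def thetaFn (θ : AddChar F ℂ) (J : NonUnitalSubalgebra F R) (lam : ↥J →ₗ[F] F) :
    ↥(algGroup F R J) → ℂ :=
  fun g => θ (lam (gElt g))

/-- Left multiplication by the group element `g` as a linear endomorphism of `J`. -/
def lmulMap {J : NonUnitalSubalgebra F R} (g : ↥(algGroup F R J)) : ↥J →ₗ[F] ↥J where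
  toFun X := ⟨((g : Rˣ) : R) * (X : R), by
    have h : ((g : Rˣ) : R) * (X : R) = (((g : Rˣ) : R) - 1) * (X : R) + (X : R) := by
      noncomm_ring
    rw [h]; exact add_mem (mul_mem g.2.1 X.2) X.2⟩
  map_add' X Y := by ext; simp [mul_add]
  map_smul' c X := by ext; simp [mul_smul_comm]

/-- Right multiplication by the group element `g` as a linear endomorphism of `J`. -/
def rmulMap {J : NonUnitalSubalgebra F R} (g : ↥(algGroup F R J)) : ↥J →ₗ[F] ↥J where
  toFun X := ⟨(X : R) * ((g : Rˣ) : R), by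
    have h : (X : R) * ((g : Rˣ) : R) = (X : R) * (((g : Rˣ) : R) - 1) + (X : R) := by
      noncomm_ring
    rw [h]; exact add_mem (mul_mem X.2 g.2.1) X.2⟩
  map_add' X Y := by ext; simp [add_mul]
  map_smul' c X := by ext; simp [smul_mul_assoc]

/-- The left action of `G` on the dual space: `(gλ)(X) = λ(g⁻¹ X)`. -/
def leftAct {J : NonUnitalSubalgebra F R} (g : ↥(algGroup F R J)) (lam : ↥J →ₗ[F] F) :
    ↥J →ₗ[F] F :=
  lam.comp (lmulMap g⁻¹)

/-- The right action of `G` on the dual space: `(λg)(X) = λ(X g⁻¹)`. -/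
def rightAct {J : NonUnitalSubalgebra F R} (g : ↥(algGroup F R J)) (lam : ↥J →ₗ[F] F) :
    ↥J →ₗ[F] F :=
  lam.comp (rmulMap g⁻¹)

/-- The coadjoint action of `G` on the dual space: `λ^g(X) = λ(g X g⁻¹)`. -/
def coAct {J : NonUnitalSubalgebra F R} (g : ↥(algGroup F R J)) (lam : ↥J →ₗ[F] F) :
    ↥J →ₗ[F] F :=
  lam.comp ((lmulMap g).comp (rmulMap g⁻¹))

/-- The left orbit `Gλ`. -/
def leftOrbit (J : NonUnitalSubalgebra F R) (lam : ↥J →ₗ[F] F) : Set (↥J →ₗ[F] F) :=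
  Set.range fun g : ↥(algGroup F R J) => leftAct g lam

/-- The right orbit `λG`. -/
def rightOrbit (J : NonUnitalSubalgebra F R) (lam : ↥J →ₗ[F] F) : Set (↥J →ₗ[F] F) :=
  Set.range fun g : ↥(algGroup F R J) => rightAct g lam

/-- The two-sided orbit `GλG`. -/
def twoOrbit (J : NonUnitalSubalgebra F R) (lam : ↥J →ₗ[F] F) : Set (↥J →ₗ[F] F) :=
  {mu | ∃ g h : ↥(algGroup F R J), mu = leftAct g (rightAct h lam)}

/-- The coadjoint orbit `λ^G`. -/
def coOrbit (J : NonUnitalSubalgebra F R) (lam : ↥J →ₗ[F] F) : Set (↥J →ₗ[F] F) :=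
  Set.range fun g : ↥(algGroup F R J) => coAct g lam

/-- The right orbit of `λ` under a subgroup `H` of the algebra group. -/
def rightOrbitUnder (J : NonUnitalSubalgebra F R) (H : Subgroup ↥(algGroup F R J))
    (lam : ↥J →ₗ[F] F) : Set (↥J →ₗ[F] F) :=
  {mu | ∃ s ∈ H, mu = rightAct s lam}

/-- The Kirillov function `ψ_λ = |λ^G|^{-1/2} ∑_{μ ∈ λ^G} θ_μ`. -/
def kirillov (θ : AddChar F ℂ) (J : NonUnitalSubalgebra F R) (lam : ↥J →ₗ[F] F) :
    ↥(algGroup F R J) → ℂ :=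
  fun g => ((Real.sqrt (Nat.card ↥(coOrbit J lam)) : ℂ))⁻¹ *
    ∑ᶠ mu ∈ coOrbit J lam, thetaFn θ J mu g

/-- The supercharacter `χ_λ = (|Gλ|/|GλG|) ∑_{μ ∈ GλG} θ_μ`. -/
def superchar (θ : AddChar F ℂ) (J : NonUnitalSubalgebra F R) (lam : ↥J →ₗ[F] F) :
    ↥(algGroup F R J) → ℂ :=
  fun g => ((Nat.card ↥(leftOrbit J lam) : ℂ) / (Nat.card ↥(twoOrbit J lam) : ℂ)) *
    ∑ᶠ mu ∈ twoOrbit J lam, thetaFn θ J mu g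

/-! ### The subalgebras `𝔩_λ`, `𝔰_λ` and their iterates -/

/-- The extension of `λ : J → F` by zero to all of `R`. -/
def lamE (J : NonUnitalSubalgebra F R) (lam : ↥J →ₗ[F] F) (x : R) : F :=
  if h : x ∈ J then lam ⟨x, h⟩ else 0

theorem lamE_apply (J : NonUnitalSubalgebra F R) (lam : ↥J →ₗ[F] F) {x : R} (hx : x ∈ J) :
    lamE J lam x = lam ⟨x, hx⟩ := dif_pos hx

theorem lamE_zero (J : NonUnitalSubalgebra F R) (lam : ↥J →ₗ[F] F) : lamE J lam 0 = 0 := by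
  rw [lamE_apply J lam J.zero_mem]
  have h : (⟨(0 : R), J.zero_mem⟩ : ↥J) = 0 := Subtype.ext rfl
  rw [h, map_zero]

theorem lamE_add (J : NonUnitalSubalgebra F R) (lam : ↥J →ₗ[F] F) {x y : R}
    (hx : x ∈ J) (hy : y ∈ J) : lamE J lam (x + y) = lamE J lam x + lamE J lam y := by
  rw [lamE, lamE, lamE, dif_pos (add_mem hx hy), dif_pos hx, dif_pos hy]
  have h : (⟨x + y, add_mem hx hy⟩ : ↥J) = ⟨x, hx⟩ + ⟨y, hy⟩ := Subtype.ext rfl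
  rw [h, map_add]

theorem lamE_smul (J : NonUnitalSubalgebra F R) (lam : ↥J →ₗ[F] F) (c : F) {x : R}
    (hx : x ∈ J) : lamE J lam (c • x) = c * lamE J lam x := by
  rw [lamE, lamE, dif_pos (SMulMemClass.smul_mem c hx), dif_pos hx]
  have h : (⟨c • x, SMulMemClass.smul_mem c hx⟩ : ↥J) = c • ⟨x, hx⟩ := Subtype.ext rfl
  rw [h, map_smul]
  rfl

/-- The left kernel `𝔩` of the bilinear form `(X,Y) ↦ λ(XY)` restricted to `s × s`. -/
def lStep (J : NonUnitalSubalgebra F R) (lam : ↥J →ₗ[F] F)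
    (s : NonUnitalSubalgebra F R) (hs : s ≤ J) : NonUnitalSubalgebra F R where
  carrier := {x | x ∈ s ∧ ∀ y ∈ s, lamE J lam (x * y) = 0}
  zero_mem' := ⟨zero_mem s, fun y _ => by rw [zero_mul, lamE_zero]⟩
  add_mem' := by
    rintro a b ⟨ha1, ha2⟩ ⟨hb1, hb2⟩
    refine ⟨add_mem ha1 hb1, fun y hy => ?_⟩
    rw [add_mul, lamE_add J lam (J.mul_mem (hs ha1) (hs hy)) (J.mul_mem (hs hb1) (hs hy)),
      ha2 y hy, hb2 y hy, add_zero]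
  smul_mem' := by
    rintro c a ⟨ha1, ha2⟩
    refine ⟨SMulMemClass.smul_mem c ha1, fun y hy => ?_⟩
    rw [smul_mul_assoc, lamE_smul J lam c (J.mul_mem (hs ha1) (hs hy)), ha2 y hy, mul_zero]
  mul_mem' := by
    rintro a b ⟨ha1, ha2⟩ ⟨hb1, hb2⟩
    refine ⟨mul_mem ha1 hb1, fun y hy => ?_⟩
    rw [mul_assoc]
    exact ha2 (b * y) (mul_mem hb1 hy)

theorem lStep_le (J : NonUnitalSubalgebra F R) (lam : ↥J →ₗ[F] F)
    (s : NonUnitalSubalgebra F R) (hs : s ≤ J) : lStep J lam s hs ≤ s :=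
  fun _ hx => hx.1

/-- The left kernel `𝔰` of the bilinear form `(X,Y) ↦ λ(XY)` restricted to `s × 𝔩`. -/
def sStep (J : NonUnitalSubalgebra F R) (lam : ↥J →ₗ[F] F)
    (s : NonUnitalSubalgebra F R) (hs : s ≤ J) : NonUnitalSubalgebra F R where
  carrier := {x | x ∈ s ∧ ∀ y ∈ lStep J lam s hs, lamE J lam (x * y) = 0}
  zero_mem' := ⟨zero_mem s, fun y _ => by rw [zero_mul, lamE_zero]⟩
  add_mem' := by
    rintro a b ⟨ha1, ha2⟩ ⟨hb1, hb2⟩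
    refine ⟨add_mem ha1 hb1, fun y hy => ?_⟩
    rw [add_mul, lamE_add J lam (J.mul_mem (hs ha1) (hs hy.1)) (J.mul_mem (hs hb1) (hs hy.1)),
      ha2 y hy, hb2 y hy, add_zero]
  smul_mem' := by
    rintro c a ⟨ha1, ha2⟩
    refine ⟨SMulMemClass.smul_mem c ha1, fun y hy => ?_⟩
    rw [smul_mul_assoc, lamE_smul J lam c (J.mul_mem (hs ha1) (hs hy.1)), ha2 y hy, mul_zero]
  mul_mem' := by
    rintro a b ⟨ha1, ha2⟩ ⟨hb1, hb2⟩
    refine ⟨mul_mem ha1 hb1, fun y hy => ?_⟩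
    rw [mul_assoc]
    refine ha2 (b * y) ⟨mul_mem hb1 hy.1, fun z hz => ?_⟩
    rw [mul_assoc]
    refine hb2 (y * z) ⟨mul_mem hy.1 hz, fun w hw => ?_⟩
    rw [mul_assoc]
    exact hy.2 (z * w) (mul_mem hz hw)

theorem sStep_le (J : NonUnitalSubalgebra F R) (lam : ↥J →ₗ[F] F)
    (s : NonUnitalSubalgebra F R) (hs : s ≤ J) : sStep J lam s hs ≤ s :=
  fun _ hx => hx.1

/-- `𝔩_λ`: the left kernel of `(X,Y) ↦ λ(XY)` on `J × J`. -/
def lone (J : NonUnitalSubalgebra F R) (lam : ↥J →ₗ[F] F) : NonUnitalSubalgebra F R :=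
  lStep J lam J le_rfl

/-- `𝔰_λ`: the left kernel of `(X,Y) ↦ λ(XY)` on `J × 𝔩_λ`. -/
def sone (J : NonUnitalSubalgebra F R) (lam : ↥J →ₗ[F] F) : NonUnitalSubalgebra F R :=
  sStep J lam J le_rfl

theorem lone_le (J : NonUnitalSubalgebra F R) (lam : ↥J →ₗ[F] F) : lone J lam ≤ J :=
  lStep_le J lam J le_rfl

theorem sone_le (J : NonUnitalSubalgebra F R) (lam : ↥J →ₗ[F] F) : sone J lam ≤ J :=
  sStep_le J lam J le_rfl

/-- `𝔨_λ = 𝔩_λ ∩ ker λ`. -/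
def kone (J : NonUnitalSubalgebra F R) (lam : ↥J →ₗ[F] F) : NonUnitalSubalgebra F R where
  carrier := {x | x ∈ lone J lam ∧ lamE J lam x = 0}
  zero_mem' := ⟨zero_mem _, lamE_zero J lam⟩
  add_mem' := by
    rintro a b ⟨ha1, ha2⟩ ⟨hb1, hb2⟩
    exact ⟨add_mem ha1 hb1, by
      rw [lamE_add J lam (lone_le J lam ha1) (lone_le J lam hb1), ha2, hb2, add_zero]⟩
  smul_mem' := by
    rintro c a ⟨ha1, ha2⟩
    exact ⟨SMulMemClass.smul_mem c ha1, by
      rw [lamE_smul J lam c (lone_le J lam ha1), ha2, mul_zero]⟩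
  mul_mem' := by
    rintro a b ⟨ha1, ha2⟩ ⟨hb1, hb2⟩
    exact ⟨mul_mem ha1 hb1, ha1.2 b (lone_le J lam hb1)⟩

theorem kone_le (J : NonUnitalSubalgebra F R) (lam : ↥J →ₗ[F] F) : kone J lam ≤ lone J lam :=
  fun _ hx => hx.1

/-- The descending chain `𝔰_λ^0 ⊇ 𝔰_λ^1 ⊇ ⋯` (bundled with the proof `𝔰_λ^i ≤ J`). -/
def sChainAux (J : NonUnitalSubalgebra F R) (lam : ↥J →ₗ[F] F) :
    ℕ → {s : NonUnitalSubalgebra F R // s ≤ J}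
  | 0 => ⟨J, le_rfl⟩
  | n + 1 =>
    ⟨sStep J lam (sChainAux J lam n).1 (sChainAux J lam n).2,
      le_trans (sStep_le J lam (sChainAux J lam n).1 (sChainAux J lam n).2)
        (sChainAux J lam n).2⟩

/-- `𝔰_λ^i`. -/
def sChain (J : NonUnitalSubalgebra F R) (lam : ↥J →ₗ[F] F) (i : ℕ) :
    NonUnitalSubalgebra F R :=
  (sChainAux J lam i).1

/-- `𝔩_λ^{i+1}`. -/
def lChain (J : NonUnitalSubalgebra F R) (lam : ↥J →ₗ[F] F) (i : ℕ) :
    NonUnitalSubalgebra F R :=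
  lStep J lam (sChainAux J lam i).1 (sChainAux J lam i).2

/-- The terminal element `𝔰̄_λ` of the descending chain; the chain has stabilized by
stage `|R|` since it is a weakly decreasing chain of subalgebras of the finite algebra. -/
def sbar (J : NonUnitalSubalgebra F R) (lam : ↥J →ₗ[F] F) : NonUnitalSubalgebra F R :=
  sChain J lam (Fintype.card R)

theorem sbar_le (J : NonUnitalSubalgebra F R) (lam : ↥J →ₗ[F] F) : sbar J lam ≤ J :=
  (sChainAux J lam (Fintype.card R)).2

/-- The terminal element `𝔩̄_λ` of the ascending chain. -/
def lbar (J : NonUnitalSubalgebra F R) (lam : ↥J →ₗ[F] F) : NonUnitalSubalgebra F R :=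
  lStep J lam (sbar J lam) (sbar_le J lam)

theorem lbar_le (J : NonUnitalSubalgebra F R) (lam : ↥J →ₗ[F] F) : lbar J lam ≤ J :=
  le_trans (lStep_le J lam _ _) (sbar_le J lam)

/-! ### Algebra subgroups of an algebra group -/

/-- The algebra subgroup `1 + k` of `1 + J`, as a subgroup of the ambient algebra group. -/
def algSubgroup (k J : NonUnitalSubalgebra F R) : Subgroup ↥(algGroup F R J) :=
  (algGroup F R k).subgroupOf (algGroup F R J)

/-- `L_λ = 1 + 𝔩_λ` as a subgroup of `G`. -/
def Lgrp (J : NonUnitalSubalgebra F R) (lam : ↥J →ₗ[F] F) : Subgroup ↥(algGroup F R J) :=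
  algSubgroup (lone J lam) J

/-- `S_λ = 1 + 𝔰_λ` as a subgroup of `G`. -/
def Sgrp (J : NonUnitalSubalgebra F R) (lam : ↥J →ₗ[F] F) : Subgroup ↥(algGroup F R J) :=
  algSubgroup (sone J lam) J

/-- `L̄_λ = 1 + 𝔩̄_λ` as a subgroup of `G`. -/
def Lbarg (J : NonUnitalSubalgebra F R) (lam : ↥J →ₗ[F] F) : Subgroup ↥(algGroup F R J) :=
  algSubgroup (lbar J lam) J

/-- `S̄_λ = 1 + 𝔰̄_λ` as a subgroup of `G`. -/
def Sbarg (J : NonUnitalSubalgebra F R) (lam : ↥J →ₗ[F] F) : Subgroup ↥(algGroup F R J) :=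
  algSubgroup (sbar J lam) J

/-- Passing from an element of the subgroup `1 + k ≤ 1 + J` to an element of the
algebra group `1 + k` in its own right. -/
def toAlg {k J : NonUnitalSubalgebra F R} (x : ↥(algSubgroup k J)) : ↥(algGroup F R k) :=
  ⟨((x : ↥(algGroup F R J)) : Rˣ), Subgroup.mem_subgroupOf.mp x.2⟩

/-- The linear inclusion of a smaller subalgebra. -/
def inclMap {s J : NonUnitalSubalgebra F R} (h : s ≤ J) : ↥s →ₗ[F] ↥J where
  toFun x := ⟨(x : R), h x.2⟩
  map_add' x y := rfl
  map_smul' c x := rfl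

/-- Restriction of a functional on `J` to a smaller subalgebra. -/
def resTo {s J : NonUnitalSubalgebra F R} (h : s ≤ J) (lam : ↥J →ₗ[F] F) : ↥s →ₗ[F] F :=
  lam.comp (inclMap h)

/-- The character `ξ_λ = Ind_{L̄_λ}^G (θ_λ)`. -/
def xi (θ : AddChar F ℂ) (J : NonUnitalSubalgebra F R) (lam : ↥J →ₗ[F] F) :
    ↥(algGroup F R J) → ℂ :=
  indFun (Lbarg J lam) (fun x => thetaFn θ J lam ↑x)

/-- The set `Ξ_λ = {g λ s g⁻¹ : g ∈ G, s ∈ S̄_λ}`. -/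
def Xi (J : NonUnitalSubalgebra F R) (lam : ↥J →ₗ[F] F) : Set (↥J →ₗ[F] F) :=
  {nu | ∃ g : ↥(algGroup F R J), ∃ s ∈ Sbarg J lam, nu = coAct g (rightAct s lam)}

/-! ### Normality of algebra subgroups coming from ideals -/

theorem conj_mem_aux (s a : NonUnitalSubalgebra F R)
    (hl : ∀ x ∈ s, ∀ y ∈ a, x * y ∈ a) (hr : ∀ y ∈ a, ∀ x ∈ s, y * x ∈ a)
    (u : Rˣ) (hu1 : (u : R) - 1 ∈ s) (hu2 : ((u⁻¹ : Rˣ) : R) - 1 ∈ s)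
    (x : Rˣ) (hx : (x : R) - 1 ∈ a) : ((u * x * u⁻¹ : Rˣ) : R) - 1 ∈ a := by
  have h1 : (u : R) * ((u⁻¹ : Rˣ) : R) = 1 := Units.mul_inv u
  have key : ((u * x * u⁻¹ : Rˣ) : R) - 1 =
      ((u : R) - 1) * ((x : R) - 1) * (((u⁻¹ : Rˣ) : R) - 1) +
        ((u : R) - 1) * ((x : R) - 1) + ((x : R) - 1) * (((u⁻¹ : Rˣ) : R) - 1) +
        ((x : R) - 1) := by
    push_cast
    calc (u : R) * (x : R) * ((u⁻¹ : Rˣ) : R) - 1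
        = (u : R) * (x : R) * ((u⁻¹ : Rˣ) : R) - (u : R) * ((u⁻¹ : Rˣ) : R) := by rw [h1]
      _ = _ := by noncomm_ring
  rw [key]
  exact add_mem (add_mem (add_mem (hr _ (hl _ hu1 _ hx) _ hu2) (hl _ hu1 _ hx))
    (hr _ hx _ hu2)) hx

theorem algSubgroup_normal (s a : NonUnitalSubalgebra F R)
    (hl : ∀ x ∈ s, ∀ y ∈ a, x * y ∈ a) (hr : ∀ y ∈ a, ∀ x ∈ s, y * x ∈ a) :
    ((algGroup F R a).subgroupOf (algGroup F R s)).Normal := by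
  constructor
  intro n hn g
  rw [Subgroup.mem_subgroupOf] at hn ⊢
  have hginv : ((g⁻¹ : ↥(algGroup F R s)) : Rˣ) = ((g : Rˣ))⁻¹ := rfl
  have hcoe : ((g * n * g⁻¹ : ↥(algGroup F R s)) : Rˣ) = (g : Rˣ) * (n : Rˣ) * ((g : Rˣ))⁻¹ := by
    push_cast [hginv]; rfl
  rw [mem_algGroup]
  constructor
  · rw [hcoe]
    exact conj_mem_aux s a hl hr (g : Rˣ) (g : ↥(algGroup F R s)).2.1 (g : ↥(algGroup F R s)).2.2
      (n : Rˣ) hn.1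
  · have hinv : (((g * n * g⁻¹ : ↥(algGroup F R s)) : Rˣ))⁻¹ =
        (g : Rˣ) * ((n : Rˣ))⁻¹ * ((g : Rˣ))⁻¹ := by
      rw [hcoe]; group
    rw [hinv]
    exact conj_mem_aux s a hl hr (g : Rˣ) (g : ↥(algGroup F R s)).2.1 (g : ↥(algGroup F R s)).2.2
      ((n : Rˣ))⁻¹ hn.2

theorem lone_mul_mem (J : NonUnitalSubalgebra F R) (lam : ↥J →ₗ[F] F)
    {y z : R} (hy : y ∈ lone J lam) (hz : z ∈ J) : y * z ∈ lone J lam := by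
  refine ⟨J.mul_mem (lone_le J lam hy) hz, fun w hw => ?_⟩
  rw [mul_assoc]
  exact hy.2 (z * w) (J.mul_mem hz hw)

theorem sone_mul_lone_mem (J : NonUnitalSubalgebra F R) (lam : ↥J →ₗ[F] F)
    {x y : R} (hx : x ∈ sone J lam) (hy : y ∈ lone J lam) : x * y ∈ lone J lam := by
  refine ⟨J.mul_mem (sone_le J lam hx) (lone_le J lam hy), fun w hw => ?_⟩
  rw [mul_assoc]
  exact hx.2 (y * w) (lone_mul_mem J lam hy hw)

theorem kone_ideal_left (J : NonUnitalSubalgebra F R) (lam : ↥J →ₗ[F] F) :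
    ∀ x ∈ sone J lam, ∀ y ∈ kone J lam, x * y ∈ kone J lam := by
  intro x hx y hy
  exact ⟨sone_mul_lone_mem J lam hx hy.1, hx.2 y hy.1⟩

theorem kone_ideal_right (J : NonUnitalSubalgebra F R) (lam : ↥J →ₗ[F] F) :
    ∀ y ∈ kone J lam, ∀ x ∈ sone J lam, y * x ∈ kone J lam := by
  intro y hy x hx
  exact ⟨lone_mul_mem J lam hy.1 (sone_le J lam hx), hy.1.2 x (sone_le J lam hx)⟩

/-- `K_λ = 1 + 𝔨_λ` as a (normal) subgroup of `S_λ = 1 + 𝔰_λ`. -/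
def KgrpIn (J : NonUnitalSubalgebra F R) (lam : ↥J →ₗ[F] F) :
    Subgroup ↥(algGroup F R (sone J lam)) :=
  (algGroup F R (kone J lam)).subgroupOf (algGroup F R (sone J lam))

instance KgrpIn_normal (J : NonUnitalSubalgebra F R) (lam : ↥J →ₗ[F] F) :
    (KgrpIn J lam).Normal :=
  algSubgroup_normal (sone J lam) (kone J lam) (kone_ideal_left J lam) (kone_ideal_right J lam)

/-- `L_λ = 1 + 𝔩_λ` as a (normal) subgroup of `S_λ = 1 + 𝔰_λ`. -/
def LgrpIn (J : NonUnitalSubalgebra F R) (lam : ↥J →ₗ[F] F) :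
    Subgroup ↥(algGroup F R (sone J lam)) :=
  (algGroup F R (lone J lam)).subgroupOf (algGroup F R (sone J lam))

instance LgrpIn_normal (J : NonUnitalSubalgebra F R) (lam : ↥J →ₗ[F] F) :
    (LgrpIn J lam).Normal :=
  algSubgroup_normal (sone J lam) (lone J lam)
    (fun x hx y hy => sone_mul_lone_mem J lam hx hy)
    (fun y hy x hx => lone_mul_mem J lam hy (sone_le J lam hx))

theorem isCharacter_of_representation {G V : Type} [Group G] [AddCommGroup V] [Module ℂ V]
    [Module.Finite ℂ V] (ρ : Representation ℂ G V) :
    IsCharacter G fun g => LinearMap.trace ℂ V (ρ g) :=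
  ⟨FDRep.of ρ, rfl⟩

theorem isCharacter_average {G K V : Type} [Group G] [Group K] [Fintype K] [AddCommGroup V]
    [Module ℂ V] [Module.Finite ℂ V] (ρ : Representation ℂ G V) (P : Representation ℂ K V)
    (hcomm : ∀ g, ρ g * ∑ k, P k = (∑ k, P k) * ρ g) :
    IsCharacter G fun g => (Fintype.card K : ℂ)⁻¹ * ∑ k, LinearMap.trace ℂ V (ρ g * P k) := by
  have : Invertible (Fintype.card K : ℂ) :=
    invertibleOfNonzero (Nat.cast_ne_zero.mpr Fintype.card_ne_zero)
  have havg : P.averageMap = (Fintype.card K : ℂ)⁻¹ • ∑ k, P k := by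
    simp [Representation.averageMap, GroupAlgebra.average, map_sum]
  have hproj := P.isProj_averageMap
  have hcomm' : ∀ g v, ρ g (P.averageMap v) = P.averageMap (ρ g v) := by
    intro g v
    have h := LinearMap.congr_fun (hcomm g) v
    simp only [Module.End.mul_apply] at h
    rw [havg, LinearMap.smul_apply, LinearMap.smul_apply, map_smul, h]
  have hinv : ∀ g, ∀ v ∈ P.invariants, ρ g v ∈ P.invariants := by
    intro g v hv
    rw [← hproj.map_id v hv, hcomm']
    exact hproj.map_mem _
  let σ : Representation ℂ G P.invariants :=
    { toFun := fun g => (ρ g).restrict (hinv g)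
      map_one' := by ext; simp
      map_mul' := fun g h => by ext; simp }
  convert isCharacter_of_representation σ using 2 with g
  have hmem : ∀ v, (ρ g * P.averageMap) v ∈ P.invariants := fun v =>
    hinv g _ (hproj.map_mem v)
  have hσ : σ g = (ρ g * P.averageMap).restrict fun v _ => hmem v := by
    ext v
    exact congrArg (ρ g) (hproj.map_id v v.2).symm
  rw [hσ, LinearMap.trace_restrict_eq_of_forall_mem _ _ hmem, havg]
  simp [Finset.mul_sum]

theorem trace_pi_reindex {X W : Type} [Fintype X] [AddCommGroup W] [Module ℂ W]
    [Module.Finite ℂ W] (A : W →ₗ[ℂ] W) (f : X → X) :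
    LinearMap.trace ℂ (X → W) (LinearMap.pi fun x => A ∘ₗ LinearMap.proj (f x)) =
      ∑ x, if f x = x then LinearMap.trace ℂ W A else 0 := by
  let b := Module.finBasis ℂ W
  rw [LinearMap.trace_eq_matrix_trace ℂ (Pi.basis fun _ : X => b),
    LinearMap.trace_eq_matrix_trace ℂ b, Matrix.trace, Fintype.sum_sigma]
  refine Finset.sum_congr rfl fun x _ => ?_
  split_ifs with h
  · refine Finset.sum_congr rfl fun i _ => ?_
    simp [LinearMap.toMatrix_apply, Pi.basis_repr, Pi.basis_apply, h]
  · refine Finset.sum_eq_zero fun i _ => ?_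
    simp [LinearMap.toMatrix_apply, Pi.basis_repr, Pi.basis_apply, h]

theorem isCharacter_induced {G S : Type} [Group G] [Group S] [Fintype G] [Fintype S]
    (i : S →* G) {χ : S → ℂ} (hχ : IsCharacter S χ) :
    IsCharacter G fun g =>
      (Fintype.card S : ℂ)⁻¹ * ∑ s, ∑ x, if x * g * x⁻¹ = i s then χ s else 0 := by
  obtain ⟨W, rfl⟩ := hχ
  let ρ : Representation ℂ G (G → W) :=
    { toFun := fun g => LinearMap.funLeft ℂ W fun x => x * g
      map_one' := by ext; simp [LinearMap.funLeft]
      map_mul' := fun g h => by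
        refine LinearMap.ext fun f => funext fun x => ?_
        simp [LinearMap.funLeft, mul_assoc] }
  let P : Representation ℂ S (G → W) :=
    { toFun := fun s => LinearMap.pi fun x => W.ρ s ∘ₗ LinearMap.proj ((i s)⁻¹ * x)
      map_one' := by
        refine LinearMap.ext fun f => funext fun x => ?_
        simp
      map_mul' := fun g h => by
        refine LinearMap.ext fun f => funext fun x => ?_
        simp [mul_assoc] }
  have hc : ∀ g s, ρ g * P s = P s * ρ g := by
    intro g s
    refine LinearMap.ext fun f => funext fun x => ?_
    simp [ρ, P, LinearMap.funLeft, mul_assoc]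
  convert isCharacter_average ρ P fun g => by simp [Finset.mul_sum, Finset.sum_mul, hc]
    using 5 with g s
  have h : ρ g * P s =
      LinearMap.pi fun x => W.ρ s ∘ₗ LinearMap.proj ((i s)⁻¹ * (x * g)) := by
    refine LinearMap.ext fun f => funext fun x => ?_
    simp [ρ, P, LinearMap.funLeft]
  rw [h, trace_pi_reindex]
  refine Finset.sum_congr rfl fun x _ => if_congr ?_ rfl rfl
  rw [inv_mul_eq_iff_eq_mul, mul_inv_eq_iff_eq_mul]

/-- The average of `τ` over conjugates by the image of a group hom, up to normalization. -/
def conjSum {G S : Type} [Group G] [Group S] [Fintype S] (i : S →* G) (τ : G → ℂ) (x : G) : ℂ :=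
  ∑ s, τ (i s * x * (i s)⁻¹)

/-- Compatibility of a function `τ` on `G` with a linear character `φ` on a normal
subgroup `L` of a subgroup `S` of `G`. -/
structure Inducing {G S L : Type} [Group G] [Group S] [Group L] [Fintype G] [Fintype S]
    [Fintype L] (i : S →* G) (j : L →* S) (τ : G → ℂ) (φ : L →* ℂ) : Prop where
  inj_i : Function.Injective i
  inj_j : Function.Injective j
  conj_sum : ∀ x, ∑ l, τ (i (j l) * x * (i (j l))⁻¹) =
    if x ∈ i.range then Fintype.card L * τ x else 0
  twisted_sum : ∀ g (h : S), ∑ l, φ l * τ (g * i (h * j l) * g⁻¹) =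
    if g ∈ i.range then Fintype.card L * τ (g * i h * g⁻¹) else 0
  star_mul : ∀ (x : S) l, (starRingEnd ℂ) (τ (i (x * j l))) = (starRingEnd ℂ) (τ (i x)) * φ l
  conj_eq : ∀ (h : S) l, ∃ l', h * j l = j l' * h ∧ φ l' = φ l

theorem sum_range_eq {G S : Type} [Group G] [Group S] [Fintype G] [Fintype S] {i : S →* G}
    (hi : Function.Injective i) (f : G → ℂ) :
    (∑ g, if g ∈ i.range then f g else 0) = ∑ s, f (i s) := by
  rw [← Finset.sum_filter]
  symm
  refine Finset.sum_bij (fun s _ => i s) ?_ ?_ ?_ ?_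
  · simp
  · intro a _ b _ h; exact hi h
  · intro b hb
    obtain ⟨s, rfl⟩ := (Finset.mem_filter.mp hb).2
    exact ⟨s, Finset.mem_univ _, rfl⟩
  · simp

theorem conjSum_conj {G : Type} [Group G] [Fintype G] (τ : G → ℂ) (h x : G) :
    conjSum (MonoidHom.id G) τ (h * x * h⁻¹) = conjSum (MonoidHom.id G) τ x := by
  unfold conjSum
  refine Fintype.sum_equiv (Equiv.mulRight h) _ _ fun g => ?_
  simp [mul_assoc]

namespace Inducing

variable {G S L : Type} [Group G] [Group S] [Group L] [Fintype G] [Fintype S]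
    [Fintype L] {i : S →* G} {j : L →* S} {τ : G → ℂ} {φ : L →* ℂ}

theorem card_ne_zero (L : Type) [Group L] [Fintype L] : (Fintype.card L : ℂ) ≠ 0 :=
  Nat.cast_ne_zero.mpr Fintype.card_ne_zero

theorem sum_mul_classFunction (H : Inducing i j τ φ) (c : G → ℂ)
    (hc : ∀ h x, c (h * x * h⁻¹) = c x) :
    ∑ x, τ x * c x = ∑ s, τ (i s) * c (i s) := by
  have hL := card_ne_zero L
  apply mul_left_cancel₀ hL
  calc (Fintype.card L : ℂ) * ∑ x, τ x * c x
      = ∑ l : L, ∑ x, τ (i (j l) * x * (i (j l))⁻¹) * c x := by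
        rw [← nsmul_eq_mul, ← Finset.card_univ, ← Finset.sum_const]
        refine Finset.sum_congr rfl fun l _ => ?_
        symm
        refine Fintype.sum_equiv (MulAut.conj (i (j l))).toEquiv _ _ fun x => ?_
        simp [hc]
    _ = ∑ x, if x ∈ i.range then Fintype.card L * (τ x * c x) else 0 := by
        rw [Finset.sum_comm]
        refine Finset.sum_congr rfl fun x _ => ?_
        rw [← Finset.sum_mul, H.conj_sum, ite_mul, zero_mul, mul_assoc]
    _ = _ := by rw [sum_range_eq H.inj_i, Finset.mul_sum]

theorem conjSum_eq (H : Inducing i j τ φ) (x : G) :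
    conjSum (MonoidHom.id G) τ x =
      ∑ g, if g * x * g⁻¹ ∈ i.range then τ (g * x * g⁻¹) else 0 := by
  apply mul_left_cancel₀ (card_ne_zero L)
  calc (Fintype.card L : ℂ) * conjSum (MonoidHom.id G) τ x
      = ∑ l : L, ∑ g, τ (i (j l) * (g * x * g⁻¹) * (i (j l))⁻¹) := by
        rw [← nsmul_eq_mul, ← Finset.card_univ, ← Finset.sum_const]
        refine Finset.sum_congr rfl fun l _ => ?_
        symm
        refine Fintype.sum_equiv (Equiv.mulLeft (i (j l))) _ _ fun g => ?_
        simp [mul_assoc]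
    _ = _ := by
        rw [Finset.sum_comm, Finset.mul_sum]
        refine Finset.sum_congr rfl fun g _ => ?_
        rw [H.conj_sum, mul_ite, mul_zero]

theorem twisted_conjSum (H : Inducing i j τ φ) (h : S) :
    (Fintype.card L : ℂ)⁻¹ * ∑ l, φ l * conjSum (MonoidHom.id G) τ (i (h * j l)) =
      conjSum i τ (i h) := by
  rw [inv_mul_eq_iff_eq_mul₀ (card_ne_zero L)]
  simp only [conjSum, MonoidHom.id_apply, Finset.mul_sum]
  rw [Finset.sum_comm, ← sum_range_eq H.inj_i fun g => Fintype.card L * τ (g * i h * g⁻¹)]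
  exact Finset.sum_congr rfl fun g _ => H.twisted_sum g h

theorem sum_star_conj (H : Inducing i j τ φ) (g : G) :
    ∑ x : S, (starRingEnd ℂ) (τ (i x)) * τ (g * i x * g⁻¹) =
      if g ∈ i.range then ∑ x : S, (starRingEnd ℂ) (τ (i x)) * τ (g * i x * g⁻¹) else 0 := by
  apply mul_left_cancel₀ (card_ne_zero L)
  calc (Fintype.card L : ℂ) * ∑ x : S, (starRingEnd ℂ) (τ (i x)) * τ (g * i x * g⁻¹)
      = ∑ l : L, ∑ x : S, (starRingEnd ℂ) (τ (i (x * j l))) * τ (g * i (x * j l) * g⁻¹) := by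
        rw [← nsmul_eq_mul, ← Finset.card_univ, ← Finset.sum_const]
        refine Finset.sum_congr rfl fun l _ => ?_
        symm
        exact Fintype.sum_equiv (Equiv.mulRight (j l)) _ _ fun x => rfl
    _ = ∑ x : S, (starRingEnd ℂ) (τ (i x)) * ∑ l : L, φ l * τ (g * i (x * j l) * g⁻¹) := by
        rw [Finset.sum_comm]
        refine Finset.sum_congr rfl fun x _ => ?_
        rw [Finset.mul_sum]
        refine Finset.sum_congr rfl fun l _ => ?_
        rw [H.star_mul, mul_assoc]
    _ = _ := by
        simp only [H.twisted_sum]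
        split_ifs
        · rw [Finset.mul_sum]
          exact Finset.sum_congr rfl fun x _ => mul_left_comm _ _ _
        · simp

theorem sum_conjSum_mul_star {G : Type} [Group G] [Fintype G] (τ c : G → ℂ)
    (hc : ∀ h x, c (h * x * h⁻¹) = c x) :
    ∑ x, conjSum (MonoidHom.id G) τ x * c x = Fintype.card G * ∑ x, τ x * c x := by
  simp only [conjSum, MonoidHom.id_apply, Finset.sum_mul]
  rw [Finset.sum_comm, ← nsmul_eq_mul, ← Finset.card_univ, ← Finset.sum_const]
  refine Finset.sum_congr rfl fun g _ => ?_
  refine Fintype.sum_equiv (MulAut.conj g).toEquiv _ _ fun x => ?_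
  simp [hc]

theorem sum_normSq (H : Inducing i j τ φ) :
    Fintype.card S * ∑ x, conjSum (MonoidHom.id G) τ x *
        (starRingEnd ℂ) (conjSum (MonoidHom.id G) τ x) =
      Fintype.card G * ∑ s, conjSum i τ (i s) * (starRingEnd ℂ) (conjSum i τ (i s)) := by
  have h₁ : ∑ x, conjSum (MonoidHom.id G) τ x *
      (starRingEnd ℂ) (conjSum (MonoidHom.id G) τ x) = Fintype.card G *
        ∑ s, τ (i s) * (starRingEnd ℂ) (conjSum (MonoidHom.id G) τ (i s)) := by
    have hc : ∀ h x, (starRingEnd ℂ) (conjSum (MonoidHom.id G) τ (h * x * h⁻¹)) =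
      (starRingEnd ℂ) (conjSum (MonoidHom.id G) τ x) := fun h x => by rw [conjSum_conj]
    rw [sum_conjSum_mul_star τ _ hc, H.sum_mul_classFunction _ hc]
  have hS : ∀ s, conjSum i τ (i s) = conjSum (MonoidHom.id S) (τ ∘ i) s := fun s => by
    simp [conjSum]
  have h₂ : ∑ s, conjSum i τ (i s) * (starRingEnd ℂ) (conjSum i τ (i s)) =
      Fintype.card S * ∑ s, τ (i s) * (starRingEnd ℂ) (conjSum i τ (i s)) := by
    simp only [hS]
    exact sum_conjSum_mul_star (τ ∘ i) _ fun h x => by rw [conjSum_conj]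
  have h₃ : ∑ s, τ (i s) * (starRingEnd ℂ) (conjSum (MonoidHom.id G) τ (i s)) =
      ∑ s, τ (i s) * (starRingEnd ℂ) (conjSum i τ (i s)) := by
    apply star_injective
    simp only [← starRingEnd_apply, map_sum, map_mul, Complex.conj_conj]
    simp only [conjSum, MonoidHom.id_apply, Finset.mul_sum]
    rw [Finset.sum_comm, Finset.sum_comm (γ := S),
      ← sum_range_eq H.inj_i fun g => ∑ x : S, (starRingEnd ℂ) (τ (i x)) * τ (g * i x * g⁻¹)]
    exact Finset.sum_congr rfl fun g _ => H.sum_star_conj g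
  rw [h₁, h₂, h₃]
  ring

theorem isCharacter_of_restrict (H : Inducing i j τ φ) (c : ℂ)
    (hc : IsCharacter S fun s => c * conjSum i τ (i s)) :
    IsCharacter G fun g => c * conjSum (MonoidHom.id G) τ g := by
  convert isCharacter_induced i hc using 2 with g
  rw [eq_inv_mul_iff_mul_eq₀ (card_ne_zero S), H.conjSum_eq]
  calc (Fintype.card S : ℂ) *
        (c * ∑ x, if x * g * x⁻¹ ∈ i.range then τ (x * g * x⁻¹) else 0)
      = ∑ t : S, ∑ x, c * if x * g * x⁻¹ ∈ i.range then
          τ (i t * (x * g * x⁻¹) * (i t)⁻¹) else 0 := by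
        rw [← nsmul_eq_mul, ← Finset.card_univ, ← Finset.sum_const]
        refine Finset.sum_congr rfl fun t _ => ?_
        rw [Finset.mul_sum]
        symm
        refine Fintype.sum_equiv (Equiv.mulLeft (i t)) _ _ fun x => ?_
        have h : i t * x * g * (i t * x)⁻¹ = i t * (x * g * x⁻¹) * (i t)⁻¹ := by group
        have ht : i t ∈ i.range := ⟨t, rfl⟩
        simp only [Equiv.coe_mulLeft, h]
        simp only [Subgroup.mul_mem_cancel_right _ (inv_mem ht),
          Subgroup.mul_mem_cancel_left _ ht]
    _ = _ := by
        rw [Finset.sum_comm, Finset.sum_comm (γ := S)]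
        refine Finset.sum_congr rfl fun x _ => ?_
        by_cases hx : x * g * x⁻¹ ∈ i.range
        · obtain ⟨s, hs⟩ := hx
          have hs' : ∀ s', (i s = i s') = (s = s') := fun s' => propext H.inj_i.eq_iff
          simp [← hs, hs', conjSum, Finset.mul_sum]
        · have hx' : ∀ s, x * g * x⁻¹ ≠ i s := fun s h => hx ⟨s, h.symm⟩
          simp [hx, hx']

theorem isCharacter_restrict (H : Inducing i j τ φ) (c : ℂ)
    (hc : IsCharacter G fun g => c * conjSum (MonoidHom.id G) τ g) :
    IsCharacter S fun s => c * conjSum i τ (i s) := by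
  obtain ⟨V, hV⟩ := hc
  let P : Representation ℂ L V :=
    { toFun := fun l => φ l • V.ρ (i (j l))
      map_one' := by simp
      map_mul' := fun l l' => by simp [smul_smul, mul_comm] }
  have hcomm : ∀ s, (V.ρ.comp i) s * ∑ l, P l = (∑ l, P l) * (V.ρ.comp i) s := by
    intro s
    choose σ hσ hφ using H.conj_eq s
    have hinj : Function.Injective σ := fun l l' h => by
      have := (hσ l).trans ((congrArg (fun l => j l * s) h).trans (hσ l').symm)
      exact H.inj_j (mul_left_cancel this)
    rw [Finset.mul_sum, Finset.sum_mul]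
    refine Fintype.sum_bijective σ (Finite.injective_iff_bijective.mp hinj) _ _ fun l => ?_
    change V.ρ (i s) * (φ l • V.ρ (i (j l))) = (φ (σ l) • V.ρ (i (j (σ l)))) * V.ρ (i s)
    rw [mul_smul_comm, smul_mul_assoc, ← map_mul, ← map_mul, ← map_mul, ← map_mul, hσ, hφ]
  convert isCharacter_average (V.ρ.comp i) P hcomm using 2 with s
  rw [← H.twisted_conjSum, mul_left_comm, Finset.mul_sum]
  congr 1
  refine Finset.sum_congr rfl fun l _ => ?_
  have h := congrFun hV (i (s * j l))
  rw [mul_left_comm, h]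
  change _ = LinearMap.trace ℂ V (V.ρ (i s) * (φ l • V.ρ (i (j l))))
  rw [mul_smul_comm, ← map_mul, ← map_mul, map_smul]
  rfl

theorem isCharacter_iff (H : Inducing i j τ φ) (c : ℂ) :
    (IsCharacter G fun g => c * conjSum (MonoidHom.id G) τ g) ↔
      IsCharacter S fun s => c * conjSum i τ (i s) :=
  ⟨H.isCharacter_restrict c, H.isCharacter_of_restrict c⟩

end Inducing

section AlgebraGroups

variable {F : Type} [Field F] [Fintype F] {R : Type} [Ring R] [Algebra F R] [Fintype R]

theorem IsNil.mono {A B : NonUnitalSubalgebra F R} (hB : IsNil B) (h : A ≤ B) : IsNil A :=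
  hB.imp fun _ hN l hl => hN l fun x hx => h (hl x hx)

theorem pow_sub_one_mem {A : NonUnitalSubalgebra F R} {u : R} (hu : u - 1 ∈ A) (n : ℕ) :
    u ^ n - 1 ∈ A := by
  induction n with
  | zero => simp
  | succ n ih =>
    have h : u ^ (n + 1) - 1 = (u ^ n - 1) * (u - 1) + (u ^ n - 1) + (u - 1) := by
      rw [pow_succ]; noncomm_ring
    rw [h]
    exact add_mem (add_mem (mul_mem ih hu) ih) hu

theorem mem_algGroup_iff {A : NonUnitalSubalgebra F R} {u : Rˣ} :
    u ∈ algGroup F R A ↔ (u : R) - 1 ∈ A := by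
  refine ⟨fun h => h.1, fun h => ⟨h, ?_⟩⟩
  obtain ⟨n, hn⟩ := (mem_powers_iff_mem_zpowers (x := u) (y := u⁻¹)).mpr
    (inv_mem (Subgroup.mem_zpowers u))
  rw [← hn]
  simpa using pow_sub_one_mem h n

theorem algGroup_mono {A B : NonUnitalSubalgebra F R} (h : A ≤ B) :
    algGroup F R A ≤ algGroup F R B :=
  fun _ hu => ⟨h hu.1, h hu.2⟩

theorem gElt_bijective {A : NonUnitalSubalgebra F R} (hA : IsNil A) :
    Function.Bijective (gElt : ↥(algGroup F R A) → ↥A) := by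
  constructor
  · intro g h hgh
    have := congrArg (Subtype.val) hgh
    exact Subtype.ext (Units.ext (sub_left_injective this))
  · intro X
    obtain ⟨N, hN⟩ := hA
    have hnil : IsNilpotent (X : R) := ⟨N, by
      simpa using hN (List.replicate N (X : R))
        (fun x hx => by rw [List.eq_of_mem_replicate hx]; exact X.2) (by simp)⟩
    obtain ⟨u, hu⟩ := hnil.isUnit_one_add
    have hX : (u : R) - 1 = X := by rw [hu]; abel
    exact ⟨⟨u, mem_algGroup_iff.mpr (hX ▸ X.2)⟩, Subtype.ext hX⟩

theorem sum_addChar_linearMap {θ : AddChar F ℂ} (hθ : θ ≠ 1) {M : Type} [AddCommGroup M]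
    [Module F M] [Fintype M] (f : M →ₗ[F] F) :
    ∑ m, θ (f m) = if f = 0 then (Fintype.card M : ℂ) else 0 := by
  have h := AddChar.sum_eq_ite (θ.compAddMonoidHom f.toAddMonoidHom)
  have hiff : θ.compAddMonoidHom f.toAddMonoidHom = 0 ↔ f = 0 := by
    constructor
    · intro h0
      by_contra hf
      apply hθ
      ext a
      obtain ⟨m, rfl⟩ := LinearMap.surjective hf a
      exact DFunLike.congr_fun h0 m
    · rintro rfl
      ext m
      simp
  simp only [hiff] at h
  exact h

theorem sum_algGroup {θ : AddChar F ℂ} (hθ : θ ≠ 1) {A : NonUnitalSubalgebra F R}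
    (hA : IsNil A) (f : ↥A →ₗ[F] F) :
    ∑ l : ↥(algGroup F R A), θ (f (gElt l)) =
      if f = 0 then (Fintype.card ↥(algGroup F R A) : ℂ) else 0 := by
  have hb := gElt_bijective hA
  rw [Fintype.card_of_bijective hb, ← sum_addChar_linearMap hθ f]
  exact Fintype.sum_bijective _ hb _ _ fun l => rfl

theorem sum_algGroup_of_linearMap {θ : AddChar F ℂ} (hθ : θ ≠ 1)
    {A : NonUnitalSubalgebra F R} (hA : IsNil A) (f : R →ₗ[F] F) :
    ∑ l : ↥(algGroup F R A), θ (f (((l : Rˣ) : R) - 1)) =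
      if ∀ Y ∈ A, f Y = 0 then (Fintype.card ↥(algGroup F R A) : ℂ) else 0 := by
  have h := sum_algGroup hθ hA (f ∘ₗ A.toSubmodule.subtype)
  have hiff : f ∘ₗ A.toSubmodule.subtype = 0 ↔ ∀ Y ∈ A, f Y = 0 :=
    ⟨fun h0 Y hY => LinearMap.congr_fun h0 ⟨Y, hY⟩, fun h0 => LinearMap.ext fun Y => h0 Y Y.2⟩
  simp only [hiff] at h
  exact h

/-! ### Kirillov functions as averages over conjugates -/

theorem coAct_one {A : NonUnitalSubalgebra F R} (mu : ↥A →ₗ[F] F) : coAct 1 mu = mu := by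
  ext X
  simp [coAct, lmulMap, rmulMap]

theorem coAct_mul {A : NonUnitalSubalgebra F R} (g h : ↥(algGroup F R A))
    (mu : ↥A →ₗ[F] F) : coAct (g * h) mu = coAct h (coAct g mu) := by
  ext X
  simp [coAct, lmulMap, rmulMap, mul_assoc]

theorem thetaFn_coAct (θ : AddChar F ℂ) {A : NonUnitalSubalgebra F R} (mu : ↥A →ₗ[F] F)
    (g x : ↥(algGroup F R A)) :
    thetaFn θ A (coAct g mu) x = thetaFn θ A mu (g * x * g⁻¹) := by
  have h : (lmulMap g).comp (rmulMap g⁻¹) (gElt x) = gElt (g * x * g⁻¹) := by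
    apply Subtype.ext
    simp [gElt, lmulMap, rmulMap, mul_sub, sub_mul, mul_assoc]
  rw [thetaFn, thetaFn, coAct, LinearMap.comp_apply, h]

theorem card_coAct_fiber {A : NonUnitalSubalgebra F R} (mu : ↥A →ₗ[F] F)
    (g : ↥(algGroup F R A)) :
    (Finset.univ.filter fun a => coAct a mu = coAct g mu).card =
      (Finset.univ.filter fun a => coAct a mu = mu).card := by
  refine Finset.card_bij (fun a _ => a * g⁻¹) ?_ ?_ ?_
  · intro a ha
    simp only [Finset.mem_filter, Finset.mem_univ, true_and] at ha ⊢
    rw [coAct_mul, ha, ← coAct_mul, mul_inv_cancel, coAct_one]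
  · intro a _ b _ h
    exact mul_right_cancel h
  · intro b hb
    simp only [Finset.mem_filter, Finset.mem_univ, true_and] at hb
    refine ⟨b * g, ?_, mul_inv_cancel_right b g⟩
    simp only [Finset.mem_filter, Finset.mem_univ, true_and]
    rw [coAct_mul, hb]

theorem coe_image_coAct {A : NonUnitalSubalgebra F R} (mu : ↥A →ₗ[F] F) :
    ((Finset.univ.image fun g => coAct g mu : Finset _) : Set (↥A →ₗ[F] F)) =
      coOrbit A mu := by
  simp [coOrbit]

theorem natCard_coOrbit {A : NonUnitalSubalgebra F R} (mu : ↥A →ₗ[F] F) :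
    Nat.card ↥(coOrbit A mu) = (Finset.univ.image fun g => coAct g mu).card := by
  rw [← coe_image_coAct, Nat.card_coe_set_eq, Set.ncard_coe_finset]

theorem finsum_coOrbit {A : NonUnitalSubalgebra F R} (mu : ↥A →ₗ[F] F)
    (f : (↥A →ₗ[F] F) → ℂ) :
    ∑ᶠ nu ∈ coOrbit A mu, f nu = ∑ nu ∈ Finset.univ.image fun g => coAct g mu, f nu := by
  rw [← coe_image_coAct, finsum_mem_coe_finset]

theorem card_coOrbit_pos {A : NonUnitalSubalgebra F R} (mu : ↥A →ₗ[F] F) :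
    0 < (Finset.univ.image fun g => coAct g mu).card :=
  Finset.card_pos.mpr (Finset.univ_nonempty.image _)

theorem card_mul_sum_coOrbit {A : NonUnitalSubalgebra F R} (mu : ↥A →ₗ[F] F)
    (f : (↥A →ₗ[F] F) → ℂ) :
    (Fintype.card ↥(algGroup F R A) : ℂ) * ∑ nu ∈ Finset.univ.image fun g => coAct g mu, f nu =
      (Finset.univ.image fun g => coAct g mu).card * ∑ g, f (coAct g mu) := by
  have hfib : ∀ nu ∈ Finset.univ.image fun g => coAct g mu,
      (Finset.univ.filter fun a => coAct a mu = nu).card =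
        (Finset.univ.filter fun a => coAct a mu = mu).card := by
    intro nu hnu
    obtain ⟨g, -, rfl⟩ := Finset.mem_image.mp hnu
    exact card_coAct_fiber mu g
  have hcard : Fintype.card ↥(algGroup F R A) = (Finset.univ.image fun g => coAct g mu).card *
      (Finset.univ.filter fun a => coAct a mu = mu).card := by
    rw [← Finset.card_univ, Finset.card_eq_sum_card_image (fun g => coAct g mu) Finset.univ,
      Finset.sum_congr rfl hfib, Finset.sum_const, smul_eq_mul]
  have hsum : ∑ g, f (coAct g mu) = (Finset.univ.filter fun a => coAct a mu = mu).card *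
      ∑ nu ∈ Finset.univ.image fun g => coAct g mu, f nu := by
    rw [Finset.sum_comp f fun g => coAct g mu, Finset.mul_sum]
    refine Finset.sum_congr rfl fun nu hnu => ?_
    rw [hfib nu hnu, nsmul_eq_mul]
  rw [hcard, hsum, Nat.cast_mul, mul_assoc]

/-- The normalizing constant relating `ψ_μ` to the sum of `θ_μ` over conjugates. -/
def kirillovScale (A : NonUnitalSubalgebra F R) (mu : ↥A →ₗ[F] F) : ℝ :=
  Real.sqrt (Nat.card ↥(coOrbit A mu)) / Fintype.card ↥(algGroup F R A)

theorem kirillovScale_nonneg (A : NonUnitalSubalgebra F R) (mu : ↥A →ₗ[F] F) :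
    0 ≤ kirillovScale A mu := by
  unfold kirillovScale
  positivity

theorem kirillov_eq (θ : AddChar F ℂ) (A : NonUnitalSubalgebra F R) (mu : ↥A →ₗ[F] F)
    (x : ↥(algGroup F R A)) :
    kirillov θ A mu x =
      kirillovScale A mu * conjSum (MonoidHom.id _) (thetaFn θ A mu) x := by
  have h := card_mul_sum_coOrbit mu fun nu => thetaFn θ A nu x
  have hG : (Fintype.card ↥(algGroup F R A) : ℂ) ≠ 0 :=
    Nat.cast_ne_zero.mpr Fintype.card_ne_zero
  have hO : (0 : ℝ) < (Finset.univ.image fun g => coAct g mu).card :=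
    Nat.cast_pos.mpr (card_coOrbit_pos mu)
  have hs : ((Real.sqrt (Finset.univ.image fun g => coAct g mu).card : ℝ) : ℂ) ≠ 0 :=
    Complex.ofReal_ne_zero.mpr (Real.sqrt_pos.mpr hO).ne'
  have hss : ((Real.sqrt (Finset.univ.image fun g => coAct g mu).card : ℝ) : ℂ) *
      (Real.sqrt (Finset.univ.image fun g => coAct g mu).card : ℝ) =
      (Finset.univ.image fun g => coAct g mu).card := by
    rw [← Complex.ofReal_mul, Real.mul_self_sqrt hO.le, Complex.ofReal_natCast]
  simp only [thetaFn_coAct] at h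
  rw [kirillov, finsum_coOrbit, kirillovScale, natCard_coOrbit, conjSum]
  push_cast
  rw [inv_mul_eq_iff_eq_mul₀ hs, ← mul_assoc, mul_div_assoc', hss, div_mul_eq_mul_div,
    eq_div_iff hG, mul_comm, h]
  rfl

theorem sum_thetaFn_mul_star {θ : AddChar F ℂ} (hθ : θ ≠ 1) {A : NonUnitalSubalgebra F R}
    (hA : IsNil A) (mu nu : ↥A →ₗ[F] F) :
    ∑ x, thetaFn θ A mu x * (starRingEnd ℂ) (thetaFn θ A nu x) =
      if mu = nu then (Fintype.card ↥(algGroup F R A) : ℂ) else 0 := by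
  have h := sum_algGroup hθ hA (mu - nu)
  simp only [sub_eq_zero] at h
  rw [← h]
  refine Finset.sum_congr rfl fun x _ => ?_
  rw [thetaFn, thetaFn, ← AddChar.map_neg_eq_conj, ← AddChar.map_add_eq_mul,
    LinearMap.sub_apply, sub_eq_add_neg]

theorem sum_kirillov_mul_star {θ : AddChar F ℂ} (hθ : θ ≠ 1) {A : NonUnitalSubalgebra F R}
    (hA : IsNil A) (mu : ↥A →ₗ[F] F) :
    ∑ x, kirillov θ A mu x * (starRingEnd ℂ) (kirillov θ A mu x) =
      Fintype.card ↥(algGroup F R A) := by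
  have hO : (0 : ℝ) < (Finset.univ.image fun g => coAct g mu).card :=
    Nat.cast_pos.mpr (card_coOrbit_pos mu)
  have hss : ((Real.sqrt (Finset.univ.image fun g => coAct g mu).card : ℝ) : ℂ)⁻¹ *
      ((Real.sqrt (Finset.univ.image fun g => coAct g mu).card : ℝ) : ℂ)⁻¹ =
      ((Finset.univ.image fun g => coAct g mu).card : ℂ)⁻¹ := by
    rw [← mul_inv, ← Complex.ofReal_mul, Real.mul_self_sqrt hO.le, Complex.ofReal_natCast]
  simp only [kirillov, finsum_coOrbit, natCard_coOrbit, map_mul, map_inv₀, Complex.conj_ofReal,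
    map_sum]
  simp only [mul_mul_mul_comm, hss, ← Finset.mul_sum, Finset.sum_mul_sum]
  rw [inv_mul_eq_iff_eq_mul₀ (by exact_mod_cast hO.ne'), Finset.sum_comm]
  have h : ∀ nu ∈ Finset.univ.image fun g => coAct g mu,
      (∑ x, thetaFn θ A nu x * ∑ nu' ∈ Finset.univ.image fun g => coAct g mu,
        (starRingEnd ℂ) (thetaFn θ A nu' x)) =
      Fintype.card ↥(algGroup F R A) := by
    intro nu hnu
    simp only [Finset.mul_sum]
    rw [Finset.sum_comm]
    simp only [sum_thetaFn_mul_star hθ hA]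
    rw [Finset.sum_ite_eq, if_pos hnu]
  rw [Finset.sum_congr rfl h, Finset.sum_const, nsmul_eq_mul]

theorem kirillov_mem_Irr_iff {θ : AddChar F ℂ} (hθ : θ ≠ 1) {A : NonUnitalSubalgebra F R}
    (hA : IsNil A) (mu : ↥A →ₗ[F] F) :
    kirillov θ A mu ∈ Irr ↥(algGroup F R A) ↔
      IsCharacter ↥(algGroup F R A) (kirillov θ A mu) := by
  refine and_iff_left ?_
  rw [innerG, finsum_eq_sum_of_fintype, sum_kirillov_mul_star hθ hA, Nat.card_eq_fintype_card]
  exact inv_mul_cancel₀ (Nat.cast_ne_zero.mpr Fintype.card_ne_zero)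

/-! ### One step of the descending chain -/

/-- `C` is the left kernel of `(X, Y) ↦ Λ(XY)` on `A × A`, and `B` its left kernel on
`A × C`. -/
structure IsKernelStep (Λ : R →ₗ[F] F) (A B C : NonUnitalSubalgebra F R) : Prop where
  mem_C : ∀ x, x ∈ C ↔ x ∈ A ∧ ∀ y ∈ A, Λ (x * y) = 0
  mem_B : ∀ x, x ∈ B ↔ x ∈ A ∧ ∀ y ∈ C, Λ (x * y) = 0

namespace IsKernelStep

variable {Λ : R →ₗ[F] F} {A B C : NonUnitalSubalgebra F R}

theorem B_le (H : IsKernelStep Λ A B C) : B ≤ A := fun x hx => ((H.mem_B x).mp hx).1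

theorem C_le (H : IsKernelStep Λ A B C) : C ≤ B := fun x hx => by
  have h := (H.mem_C x).mp hx
  exact (H.mem_B x).mpr ⟨h.1, fun y hy => h.2 y ((H.mem_C y).mp hy).1⟩

theorem mul_mem_right (H : IsKernelStep Λ A B C) {x y : R} (hx : x ∈ C) (hy : y ∈ A) :
    x * y ∈ C := by
  have h := (H.mem_C x).mp hx
  refine (H.mem_C _).mpr ⟨mul_mem h.1 hy, fun z hz => ?_⟩
  rw [mul_assoc]
  exact h.2 _ (mul_mem hy hz)

theorem mul_mem_left (H : IsKernelStep Λ A B C) {x y : R} (hx : x ∈ B) (hy : y ∈ C) :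
    x * y ∈ C := by
  have h := (H.mem_B x).mp hx
  refine (H.mem_C _).mpr ⟨mul_mem h.1 ((H.mem_C y).mp hy).1, fun z hz => ?_⟩
  rw [mul_assoc]
  exact h.2 _ (H.mul_mem_right hy hz)

theorem mul_unit_mem (H : IsKernelStep Λ A B C) {x : R} {u : Rˣ} (hx : x ∈ C)
    (hu : u ∈ algGroup F R A) : x * u ∈ C := by
  have h : x * u = x * (u - 1) + x := by noncomm_ring
  rw [h]
  exact add_mem (H.mul_mem_right hx hu.1) hx

theorem unit_mul_mem (H : IsKernelStep Λ A B C) {x : R} {u : Rˣ} (hx : x ∈ C)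
    (hu : u ∈ algGroup F R B) : u * x ∈ C := by
  have h : u * x = (u - 1) * x + x := by noncomm_ring
  rw [h]
  exact add_mem (H.mul_mem_left hu.1 hx) hx

theorem map_mul_unit (H : IsKernelStep Λ A B C) {x : R} {u : Rˣ} (hx : x ∈ C)
    (hu : u ∈ algGroup F R A) : Λ (x * u) = Λ x := by
  have h : x * u = x * (u - 1) + x := by noncomm_ring
  rw [h, map_add, ((H.mem_C x).mp hx).2 _ hu.1, zero_add]

theorem map_unit_mul (H : IsKernelStep Λ A B C) {x : R} {u : Rˣ} (hx : x ∈ C)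
    (hu : u ∈ algGroup F R B) : Λ (u * x) = Λ x := by
  have h : u * x = (u - 1) * x + x := by noncomm_ring
  rw [h, map_add, ((H.mem_B _).mp hu.1).2 _ hx, zero_add]

theorem mem_algGroup_B_iff (H : IsKernelStep Λ A B C) {u : Rˣ} (hu : u ∈ algGroup F R A) :
    u ∈ algGroup F R B ↔ ∀ Y ∈ C, Λ (u * Y) = Λ Y := by
  refine ⟨fun h Y hY => H.map_unit_mul hY h, fun h => mem_algGroup_iff.mpr ?_⟩
  refine (H.mem_B _).mpr ⟨hu.1, fun Y hY => ?_⟩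
  rw [sub_mul, one_mul, map_sub, h Y hY, sub_self]

theorem mem_algGroup_B_iff_of_mul (H : IsKernelStep Λ A B C) {g h s : Rˣ}
    (hg : g ∈ algGroup F R A) (hh : h ∈ algGroup F R B) (hs : s ∈ algGroup F R A) :
    g ∈ algGroup F R B ↔
      ∀ Y ∈ C, Λ (g * h * Y * (g⁻¹ : Rˣ) * (s⁻¹ : Rˣ)) = Λ Y := by
  have hgs : ∀ Y ∈ C, Λ (Y * (g⁻¹ : Rˣ) * (s⁻¹ : Rˣ)) = Λ Y := fun Y hY => by
    rw [H.map_mul_unit (H.mul_unit_mem hY (inv_mem hg)) (inv_mem hs),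
      H.map_mul_unit hY (inv_mem hg)]
  constructor
  · intro hgB Y hY
    have h1 : (g : R) * h * Y * (g⁻¹ : Rˣ) * (s⁻¹ : Rˣ) =
        ((g * h : Rˣ) : R) * (Y * (g⁻¹ : Rˣ) * (s⁻¹ : Rˣ)) := by
      simp only [Units.val_mul, mul_assoc]
    rw [h1, H.map_unit_mul (H.mul_unit_mem (H.mul_unit_mem hY (inv_mem hg)) (inv_mem hs))
      (mul_mem hgB hh), hgs Y hY]
  · intro hall
    refine (H.mem_algGroup_B_iff hg).mpr fun Z hZ => ?_
    have hZs := H.mul_unit_mem hZ hs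
    have hZsg := H.mul_unit_mem hZs hg
    have h1 := hall _ (H.unit_mul_mem hZsg (inv_mem hh))
    rw [H.map_unit_mul hZsg (inv_mem hh), H.map_mul_unit hZs hg, H.map_mul_unit hZ hs] at h1
    rw [← h1]
    congr 1
    simp [mul_assoc]

theorem mem_algGroup_B_iff_of_mul_left (H : IsKernelStep Λ A B C) {x s : Rˣ}
    (hx : x ∈ algGroup F R A) (hs : s ∈ algGroup F R A) :
    x ∈ algGroup F R B ↔ ∀ Y ∈ C, Λ (((x : R) - 1) * (Y * (s⁻¹ : Rˣ))) = 0 := by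
  rw [mem_algGroup_iff, H.mem_B]
  constructor
  · intro h Y hY
    exact h.2 _ (H.mul_unit_mem hY (inv_mem hs))
  · intro h
    refine ⟨hx.1, fun Y hY => ?_⟩
    have := h _ (H.mul_unit_mem hY hs)
    rwa [Units.mul_inv_cancel_right] at this

/-- The linear character `1 + Y ↦ θ(-Λ(Y))` of `1 + C`. -/
def linChar (θ : AddChar F ℂ) (H : IsKernelStep Λ A B C) : ↥(algGroup F R C) →* ℂ where
  toFun l := θ (-Λ (((l : Rˣ) : R) - 1))
  map_one' := by simp
  map_mul' l l' := by
    have h : (((l * l' : ↥(algGroup F R C)) : Rˣ) : R) - 1 =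
        (((l : Rˣ) : R) - 1) * (((l' : Rˣ) : R) - 1) + (((l : Rˣ) : R) - 1) +
          (((l' : Rˣ) : R) - 1) := by
      push_cast; noncomm_ring
    have h0 := ((H.mem_C _).mp l.2.1).2 _ ((H.mem_C _).mp l'.2.1).1
    rw [← AddChar.map_add_eq_mul, h, map_add, map_add, h0, zero_add, neg_add]

theorem mem_range_inclusion (H : IsKernelStep Λ A B C) (x : ↥(algGroup F R A)) :
    x ∈ (Subgroup.inclusion (algGroup_mono H.B_le)).range ↔ (x : Rˣ) ∈ algGroup F R B := by
  constructor
  · rintro ⟨y, rfl⟩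
    exact y.2
  · intro h
    exact ⟨⟨x, h⟩, rfl⟩

theorem thetaFn_eq (θ : AddChar F ℂ) {mu : ↥A →ₗ[F] F} {s : Rˣ}
    (hmu : ∀ X : ↥A, mu X = Λ (X * (s⁻¹ : Rˣ))) (x : ↥(algGroup F R A)) :
    thetaFn θ A mu x = θ (Λ ((((x : Rˣ) : R) - 1) * (s⁻¹ : Rˣ))) := by
  rw [thetaFn, hmu]
  rfl

theorem inducing (H : IsKernelStep Λ A B C) (hA : IsNil A) {θ : AddChar F ℂ} (hθ : θ ≠ 1)
    {mu : ↥A →ₗ[F] F} {s : Rˣ} (hs : s ∈ algGroup F R B)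
    (hmu : ∀ X : ↥A, mu X = Λ (X * (s⁻¹ : Rˣ))) :
    Inducing (Subgroup.inclusion (algGroup_mono H.B_le))
      (Subgroup.inclusion (algGroup_mono H.C_le)) (thetaFn θ A mu) (linChar θ H) := by
  have hBA := algGroup_mono H.B_le
  have hCA := algGroup_mono (H.C_le.trans H.B_le)
  have hCnil := hA.mono (H.C_le.trans H.B_le)
  refine ⟨Subgroup.inclusion_injective _, Subgroup.inclusion_injective _, ?_, ?_, ?_, ?_⟩
  · intro x
    have hiff := (H.mem_range_inclusion x).trans
      (H.mem_algGroup_B_iff_of_mul_left x.2 (hBA hs))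
    simp only [thetaFn_eq θ hmu]
    have h := sum_algGroup_of_linearMap hθ hCnil
      (Λ ∘ₗ LinearMap.mulLeft F (((x : Rˣ) : R) - 1) ∘ₗ LinearMap.mulRight F ((s⁻¹ : Rˣ) : R))
    simp only [LinearMap.comp_apply, LinearMap.mulLeft_apply, LinearMap.mulRight_apply,
      ← hiff] at h
    rw [← ite_zero_mul, ← h, Finset.sum_mul]
    refine Fintype.sum_equiv (Equiv.inv _) _ _ fun l => ?_
    rw [← AddChar.map_add_eq_mul, ← map_add]
    congr 1
    have hX : ((x : Rˣ) : R) - 1 ∈ A := x.2.1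
    have h1 : (((x : Rˣ) : R) - 1) * (((l⁻¹ : Rˣ) : R) * ((s⁻¹ : Rˣ) : R)) ∈ A := by
      have := (mul_mem (inv_mem (hCA l.2)) (inv_mem (hBA hs))).1
      have h2 : (((x : Rˣ) : R) - 1) * (((l⁻¹ : Rˣ) : R) * ((s⁻¹ : Rˣ) : R)) =
          (((x : Rˣ) : R) - 1) * ((((l : Rˣ)⁻¹ * s⁻¹ : Rˣ) : R) - 1) +
            (((x : Rˣ) : R) - 1) := by
        push_cast; noncomm_ring
      rw [h2]
      exact add_mem (mul_mem hX this) hX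
    have h3 := ((H.mem_C _).mp l.2.1).2 _ h1
    rw [← sub_eq_zero, ← h3, ← map_sub]
    congr 1
    have h4 : ((l : Rˣ) : R) * ((l⁻¹ : Rˣ) : R) = 1 := Units.mul_inv _
    simp only [Subgroup.coe_mul, Subgroup.coe_inv, Subgroup.coe_inclusion, Units.val_mul,
      Equiv.inv_apply]
    rw [← sub_eq_zero] at h4
    rw [← sub_eq_zero, ← zero_mul ((s⁻¹ : Rˣ) : R), ← h4]
    noncomm_ring
  · intro g h
    have hiff := (H.mem_range_inclusion g).trans
      (H.mem_algGroup_B_iff_of_mul g.2 h.2 (hBA hs))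
    simp only [thetaFn_eq θ hmu]
    have key := sum_algGroup_of_linearMap hθ hCnil
      (Λ ∘ₗ LinearMap.mulRight F (((g⁻¹ : Rˣ) : R) * ((s⁻¹ : Rˣ) : R)) ∘ₗ
        LinearMap.mulLeft F (((g : Rˣ) : R) * ((h : Rˣ) : R)) - Λ)
    simp only [LinearMap.comp_apply, LinearMap.mulLeft_apply, LinearMap.mulRight_apply,
      LinearMap.sub_apply, sub_eq_zero, ← mul_assoc, ← hiff] at key
    rw [← ite_zero_mul, ← key, Finset.sum_mul]
    refine Finset.sum_congr rfl fun l _ => ?_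
    change θ _ * _ = _
    rw [← AddChar.map_add_eq_mul, ← AddChar.map_add_eq_mul]
    congr 1
    rw [sub_add_eq_add_sub, neg_add_eq_sub, ← map_add]
    congr 2
    simp only [map_mul, Subgroup.coe_mul, Subgroup.coe_inv, Subgroup.coe_inclusion,
      Units.val_mul]
    noncomm_ring
  · intro x l
    change _ = _ * θ _
    rw [thetaFn_eq θ hmu, thetaFn_eq θ hmu, ← AddChar.map_neg_eq_conj,
      ← AddChar.map_neg_eq_conj, ← AddChar.map_add_eq_mul, ← neg_add]
    congr 2
    have h1 : Λ (((x : Rˣ) : R) * ((((l : Rˣ) : R) - 1) * ((s⁻¹ : Rˣ) : R))) =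
        Λ (((l : Rˣ) : R) - 1) := by
      rw [H.map_unit_mul (H.mul_unit_mem l.2.1 (inv_mem (hBA hs))) x.2,
        H.map_mul_unit l.2.1 (inv_mem (hBA hs))]
    rw [← h1, ← map_add]
    congr 1
    simp only [map_mul, Subgroup.coe_mul, Subgroup.coe_inclusion, Units.val_mul]
    noncomm_ring
  · intro h l
    have h1 : ((((h : Rˣ) * l * (h : Rˣ)⁻¹ : Rˣ)) : R) - 1 =
        ((h : Rˣ) : R) * ((((l : Rˣ) : R) - 1) * (((h : Rˣ)⁻¹ : Rˣ) : R)) := by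
      have h4 : ((h : Rˣ) : R) * ((h⁻¹ : Rˣ) : R) = 1 := Units.mul_inv _
      push_cast
      rw [sub_mul, one_mul, mul_sub, h4, mul_assoc]
    have h2 := H.mul_unit_mem l.2.1 (inv_mem (hBA h.2))
    refine ⟨⟨h * l * (h : Rˣ)⁻¹, mem_algGroup_iff.mpr ?_⟩, ?_, ?_⟩
    · rw [h1]
      exact H.unit_mul_mem h2 h.2
    · apply Subtype.ext
      simp
    · change θ (-Λ (((((h : Rˣ) * l * (h : Rˣ)⁻¹ : Rˣ)) : R) - 1)) = θ _
      rw [h1, H.map_unit_mul h2 h.2, H.map_mul_unit l.2.1 (inv_mem (hBA h.2))]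

theorem isCharacter_kirillov_iff (H : IsKernelStep Λ A B C) (hA : IsNil A) {θ : AddChar F ℂ}
    (hθ : θ ≠ 1) {mu : ↥A →ₗ[F] F} {nu : ↥B →ₗ[F] F} {s : Rˣ} (hs : s ∈ algGroup F R B)
    (hmu : ∀ X : ↥A, mu X = Λ (X * (s⁻¹ : Rˣ))) (hnu : ∀ X : ↥B, nu X = Λ (X * (s⁻¹ : Rˣ))) :
    IsCharacter ↥(algGroup F R A) (kirillov θ A mu) ↔
      IsCharacter ↥(algGroup F R B) (kirillov θ B nu) := by
  have hI := H.inducing hA hθ hs hmu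
  set i := Subgroup.inclusion (algGroup_mono H.B_le)
  have hτ : ∀ x, thetaFn θ B nu x = thetaFn θ A mu (i x) := fun x => by
    rw [thetaFn_eq θ hnu, thetaFn_eq θ hmu]
    rfl
  have hsum : ∀ x, conjSum (MonoidHom.id _) (thetaFn θ B nu) x =
      conjSum i (thetaFn θ A mu) (i x) := fun x => by
    simp [conjSum, hτ]
  have hnormA := sum_kirillov_mul_star hθ hA mu
  have hnormB := sum_kirillov_mul_star hθ (hA.mono H.B_le) nu
  simp only [kirillov_eq, hsum, map_mul, Complex.conj_ofReal, mul_mul_mul_comm,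
    ← Finset.mul_sum] at hnormA hnormB
  have hGS := hI.sum_normSq
  have hG : (Fintype.card ↥(algGroup F R A) : ℂ) ≠ 0 :=
    Nat.cast_ne_zero.mpr Fintype.card_ne_zero
  have hS : (Fintype.card ↥(algGroup F R B) : ℂ) ≠ 0 :=
    Nat.cast_ne_zero.mpr Fintype.card_ne_zero
  have hscale : (kirillovScale A mu : ℂ) * kirillovScale A mu =
      kirillovScale B nu * kirillovScale B nu := by
    have hne : ∑ x, conjSum i (thetaFn θ A mu) (i x) *
        (starRingEnd ℂ) (conjSum i (thetaFn θ A mu) (i x)) ≠ 0 := by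
      intro h0
      rw [h0, mul_zero] at hnormB
      exact hS hnormB.symm
    apply mul_right_cancel₀ (mul_ne_zero hG hne)
    linear_combination (Fintype.card ↥(algGroup F R B) : ℂ) * hnormA -
      (Fintype.card ↥(algGroup F R A) : ℂ) * hnormB -
      (kirillovScale A mu : ℂ) * kirillovScale A mu * hGS
  have hscale' : kirillovScale A mu = kirillovScale B nu :=
    (mul_self_inj (kirillovScale_nonneg A mu) (kirillovScale_nonneg B nu)).mp
      (by exact_mod_cast hscale)
  have hfA : kirillov θ A mu = fun x => (kirillovScale A mu : ℂ) *
      conjSum (MonoidHom.id _) (thetaFn θ A mu) x := funext fun x => kirillov_eq θ A mu x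
  have hfB : kirillov θ B nu = fun x => (kirillovScale A mu : ℂ) *
      conjSum i (thetaFn θ A mu) (i x) := funext fun x => by
    rw [kirillov_eq, hscale', hsum]
  rw [hfA, hfB]
  exact hI.isCharacter_iff _

end IsKernelStep

theorem isKernelStep_sChain {J : NonUnitalSubalgebra F R} {lam : ↥J →ₗ[F] F} {Λ : R →ₗ[F] F}
    (hΛ : ∀ X : ↥J, Λ X = lam X) (n : ℕ) :
    IsKernelStep Λ (sChain J lam n) (sChain J lam (n + 1)) (lChain J lam n) := by
  have hle : sChain J lam n ≤ J := (sChainAux J lam n).2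
  have hE : ∀ x ∈ sChain J lam n, ∀ y ∈ sChain J lam n, lamE J lam (x * y) = Λ (x * y) :=
    fun x hx y hy => by
      rw [lamE_apply J lam (mul_mem (hle hx) (hle hy)), ← hΛ]
  constructor
  · intro x
    exact and_congr_right fun hx => forall₂_congr fun y hy => by rw [hE x hx y hy]
  · intro x
    exact and_congr_right fun hx => forall₂_congr fun y hy => by rw [hE x hx y hy.1]

theorem isCharacter_kirillov_sChain_iff {J : NonUnitalSubalgebra F R} (hJ : IsNil J)
    {θ : AddChar F ℂ} (hθ : θ ≠ 1) {lam mu : ↥J →ₗ[F] F} {s : ↥(algGroup F R J)}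
    (hmu : mu = rightAct s lam) (n : ℕ) (hs : (s : Rˣ) ∈ algGroup F R (sChain J lam n)) :
    IsCharacter ↥(algGroup F R J) (kirillov θ J mu) ↔
      IsCharacter ↥(algGroup F R (sChain J lam n))
        (kirillov θ (sChain J lam n) (resTo (sChainAux J lam n).2 mu)) := by
  obtain ⟨Λ, hΛ⟩ := LinearMap.exists_extend (p := J.toSubmodule) lam
  have hΛ' : ∀ X : ↥J, Λ X = lam X := fun X => LinearMap.congr_fun hΛ X
  have hres : ∀ k, ∀ X : ↥(sChain J lam k),
      resTo (sChainAux J lam k).2 mu X = Λ (X * ((s : Rˣ)⁻¹ : Rˣ)) := fun k X => by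
    rw [hmu]
    exact (hΛ' _).symm
  induction n with
  | zero => exact Iff.rfl
  | succ n ih =>
    have hstep := isKernelStep_sChain hΛ' n
    exact (ih (algGroup_mono hstep.B_le hs)).trans
      (hstep.isCharacter_kirillov_iff (hJ.mono (sChainAux J lam n).2) hθ hs (hres n)
        (hres (n + 1)))

end AlgebraGroups

theorem statement8 (F : Type) [Field F] [Fintype F]
    (R : Type) [Ring R] [Algebra F R] [Fintype R]
    (J : NonUnitalSubalgebra F R) (hJ : IsNil J)
    (θ : AddChar F ℂ) (hθ : θ ≠ 1)
    (lam lam' : ↥J →ₗ[F] F) (hmem : lam' ∈ rightOrbitUnder J (Sbarg J lam) lam) :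
    kirillov θ J lam' ∈ Irr ↥(algGroup F R J) ↔
      kirillov θ (sbar J lam) (resTo (sbar_le J lam) lam') ∈
        Irr ↥(algGroup F R (sbar J lam)) := by
  obtain ⟨s, hs, hlam'⟩ := hmem
  rw [kirillov_mem_Irr_iff hθ hJ, kirillov_mem_Irr_iff hθ (hJ.mono (sbar_le J lam))]
  exact isCharacter_kirillov_sChain_iff hJ hθ hlam' _ (Subgroup.mem_subgroupOf.mp hs)

end IterChar
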